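/- arXiv:math/0609563 — 2 statements merged into one kernel-verified Lean document; each statement's English description precedes it below -/
import Mathlib

section
/- For every n ≥ 2, the virtual braid group VB_n is isomorphic to the semidirect product K_n ⋊ S_n, where K_n is the group given by the presentation with generators x_{k,l} for 1 ≤ k ≠ l ≤ n and defining relations x_{i,j} x_{k,l} = x_{k,l} x_{i,j} for pairwise distinct i, j, k, l, and x_{i,k} x_{k,j} x_{i,k} = x_{k,j} x_{i,k} x_{k,j} for pairwise distinct i, j, k, and where the symmetric group S_n acts on K_n by permutation of indices: π · x_{i,j} = x_{π(i), π(j)} for π ∈ S_n. -/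
/-- The free-group letter corresponding to the braid generator `σ_{i+1}`
(0-based index `i`) of the virtual braid group on `n` strands. -/
def σg (n : ℕ) (i : Fin (n-1)) : FreeGroup (Fin (n-1) ⊕ Fin (n-1)) := FreeGroup.of (Sum.inl i)

/-- The free-group letter corresponding to the virtual generator `ρ_{i+1}`
(0-based index `i`) of the virtual braid group on `n` strands. -/
def ρg (n : ℕ) (i : Fin (n-1)) : FreeGroup (Fin (n-1) ⊕ Fin (n-1)) := FreeGroup.of (Sum.inr i)

/-- The defining relators of the virtual braid group `VB n`. -/
def vbRels (n : ℕ) : Set (FreeGroup (Fin (n-1) ⊕ Fin (n-1))) :=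
  {r | ∃ i j : Fin (n-1),
    ((i:ℕ)+1 = (j:ℕ) ∧ r = σg n i * σg n j * σg n i * (σg n j * σg n i * σg n j)⁻¹) ∨
    (((i:ℕ)+2 ≤ (j:ℕ) ∨ (j:ℕ)+2 ≤ (i:ℕ)) ∧ r = σg n i * σg n j * (σg n j * σg n i)⁻¹) ∨
    ((i:ℕ)+1 = (j:ℕ) ∧ r = ρg n i * ρg n j * ρg n i * (ρg n j * ρg n i * ρg n j)⁻¹) ∨
    (((i:ℕ)+2 ≤ (j:ℕ) ∨ (j:ℕ)+2 ≤ (i:ℕ)) ∧ r = ρg n i * ρg n j * (ρg n j * ρg n i)⁻¹) ∨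
    (r = ρg n i * ρg n i) ∨
    (((i:ℕ)+2 ≤ (j:ℕ) ∨ (j:ℕ)+2 ≤ (i:ℕ)) ∧ r = σg n i * ρg n j * (ρg n j * σg n i)⁻¹) ∨
    ((i:ℕ)+1 = (j:ℕ) ∧ r = ρg n i * ρg n j * σg n i * (σg n j * ρg n i * ρg n j)⁻¹)}

/-- The virtual braid group on `n` strands, given by its standard presentation. -/
abbrev VB (n : ℕ) : Type := PresentedGroup (vbRels n)

/-- The generator `σ_{i+1}` of `VB n`. -/
def σv (n : ℕ) (i : Fin (n-1)) : VB n := PresentedGroup.of (Sum.inl i)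

/-- The generator `ρ_{i+1}` of `VB n`. -/
def ρv (n : ℕ) (i : Fin (n-1)) : VB n := PresentedGroup.of (Sum.inr i)

/-- The transposition `(i+1, i+2)` (0-based: swapping `i` and `i+1`) in `S_n`. -/
def sw (n : ℕ) (i : Fin (n-1)) : Equiv.Perm (Fin n) :=
  Equiv.swap ⟨i.val, by have := i.isLt; omega⟩ ⟨i.val + 1, by have := i.isLt; omega⟩

/-- `μ : VB n → S_n` sends each `σ_i` to `1` and each `ρ_i` to the transposition `(i, i+1)`.
Its kernel is the normal closure `H_n` of the braid group `B_n` in `VB n`. -/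
def IsMu (n : ℕ) (μ : VB n →* Equiv.Perm (Fin n)) : Prop :=
  ∀ i : Fin (n-1), μ (σv n i) = 1 ∧ μ (ρv n i) = sw n i

/-- `ν : VB n → S_n` sends both `σ_i` and `ρ_i` to the transposition `(i, i+1)`.
Its kernel is the virtual pure braid group `VP_n`. -/
def IsNu (n : ℕ) (ν : VB n →* Equiv.Perm (Fin n)) : Prop :=
  ∀ i : Fin (n-1), ν (σv n i) = sw n i ∧ ν (ρv n i) = sw n i


/-- Index type for the generators `x_{k,l}`, `1 ≤ k ≠ l ≤ n`, of the group `K_n ≅ H_n`. -/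
def KGenIdx (n : ℕ) : Type := {p : Fin n × Fin n // p.1 ≠ p.2}

/-- The free-group letter `x_{i,j}` (equal to the junk value `1` when `i = j`). -/
def Xg (n : ℕ) (i j : Fin n) : FreeGroup (KGenIdx n) :=
  if h : i = j then 1 else FreeGroup.of ⟨(i, j), h⟩

/-- The defining relators of `K_n`: `x_{i,j} x_{k,l} = x_{k,l} x_{i,j}` for pairwise distinct
`i, j, k, l`, and `x_{i,k} x_{k,j} x_{i,k} = x_{k,j} x_{i,k} x_{k,j}` for pairwise distinct
`i, j, k`. -/
def KRels (n : ℕ) : Set (FreeGroup (KGenIdx n)) :=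
  {r | (∃ i j k l : Fin n, i ≠ j ∧ k ≠ l ∧ i ≠ k ∧ i ≠ l ∧ j ≠ k ∧ j ≠ l ∧
          r = Xg n i j * Xg n k l * (Xg n k l * Xg n i j)⁻¹) ∨
       (∃ i j k : Fin n, i ≠ j ∧ k ≠ i ∧ k ≠ j ∧
          r = Xg n i k * Xg n k j * Xg n i k * (Xg n k j * Xg n i k * Xg n k j)⁻¹)}

/-- The group `K_n`, abstractly presented; it is isomorphic to `H_n = ker μ`. -/
abbrev K (n : ℕ) : Type := PresentedGroup (KRels n)

/-- Elements `r 0, …, r (N - 1)` of a group satisfying the Coxeter relations of type `A`. -/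
structure SymmetricRelations {G : Type*} [Group G] (r : ℕ → G) (N : ℕ) : Prop where
  mul_self : ∀ i < N, r i * r i = 1
  comm : ∀ i j, i + 2 ≤ j → j < N → r i * r j = r j * r i
  braid : ∀ i, i + 1 < N → r i * r (i + 1) * r i = r (i + 1) * r i * r (i + 1)

section SymmetricRelations

variable {G : Type*} [Group G] {r : ℕ → G} {N : ℕ}

/-- The descending product `r (k + l - 1) * ⋯ * r (k + 1) * r k` of length `l`. -/
def descProd (r : ℕ → G) (k : ℕ) : ℕ → G
  | 0 => 1
  | l + 1 => r (k + l) * descProd r k l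

/-- The subgroup generated by `r 0, …, r (m - 1)`. -/
def initialSubgroup (r : ℕ → G) (m : ℕ) : Subgroup G := Subgroup.closure (r '' Set.Iio m)

lemma mem_initialSubgroup {i m : ℕ} (h : i < m) : r i ∈ initialSubgroup r m :=
  Subgroup.subset_closure ⟨i, h, rfl⟩

lemma descProd_succ' (r : ℕ → G) (k l : ℕ) :
    descProd r k (l + 1) = descProd r (k + 1) l * r k := by
  induction l with
  | zero => simp [descProd]
  | succ l ih =>
    rw [descProd, ih, descProd, mul_assoc, show k + (l + 1) = k + 1 + l by omega]

namespace SymmetricRelations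

variable (hr : SymmetricRelations r N)
include hr

lemma descProd_mul_of_add_two_le {j k l : ℕ} (hj : j + 2 ≤ k) (hl : k + l ≤ N) :
    descProd r k l * r j = r j * descProd r k l := by
  induction l with
  | zero => simp [descProd]
  | succ l ih =>
    rw [descProd, mul_assoc, ih (by omega), ← mul_assoc, ← mul_assoc,
      hr.comm j (k + l) (by omega) (by omega)]

lemma descProd_mul_of_lt {j k l : ℕ} (hk : k ≤ j) (hj : j + 1 < k + l) (hl : k + l ≤ N) :
    descProd r k l * r (j + 1) = r j * descProd r k l := by
  induction l with
  | zero => omega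
  | succ l ih =>
    rcases Nat.lt_or_ge (j + 1) (k + l) with h | h
    · rw [descProd, mul_assoc, ih h (by omega), ← mul_assoc, ← mul_assoc,
        hr.comm j (k + l) (by omega) (by omega)]
    · obtain ⟨l, rfl⟩ : ∃ l', l = l' + 1 := ⟨l - 1, by omega⟩
      obtain rfl : j = k + l := by omega
      have hc : descProd r k l * r (k + l + 1) = r (k + l + 1) * descProd r k l := by
        have key : ∀ t ≤ l, descProd r k t * r (k + l + 1) = r (k + l + 1) * descProd r k t := by
          intro t ht
          induction t with
          | zero => simp [descProd]
          | succ t iht =>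
            rw [descProd, mul_assoc, iht (by omega), ← mul_assoc, ← mul_assoc,
              hr.comm (k + t) (k + l + 1) (by omega) (by omega)]
        exact key l le_rfl
      calc descProd r k (l + 1 + 1) * r (k + l + 1)
          = r (k + l + 1) * r (k + l) * (descProd r k l * r (k + l + 1)) := by
            simp only [descProd, mul_assoc, add_assoc]
        _ = r (k + l + 1) * r (k + l) * r (k + l + 1) * descProd r k l := by
            rw [hc]; simp only [mul_assoc]
        _ = r (k + l) * descProd r k (l + 1 + 1) := by
            rw [← hr.braid (k + l) (by omega)]
            simp only [descProd, mul_assoc, add_assoc]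

lemma exists_eq_mul_descProd {m : ℕ} (hm : m < N) {x : G} (hx : x ∈ initialSubgroup r (m + 1)) :
    ∃ h ∈ initialSubgroup r m, ∃ k l, k + l = m + 1 ∧ x = h * descProd r k l := by
  have step : ∀ x, (∃ h ∈ initialSubgroup r m, ∃ k l, k + l = m + 1 ∧ x = h * descProd r k l) →
      ∀ j < m + 1,
        ∃ h ∈ initialSubgroup r m, ∃ k l, k + l = m + 1 ∧ x * r j = h * descProd r k l := by
    rintro _ ⟨h, hh, k, l, hkl, rfl⟩ j hj
    rcases lt_trichotomy (j + 1) k with hlt | rfl | hgt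
    · refine ⟨h * r j, mul_mem hh (mem_initialSubgroup (by omega)), k, l, hkl, ?_⟩
      rw [mul_assoc, hr.descProd_mul_of_add_two_le (by omega) (by omega), mul_assoc]
    · exact ⟨h, hh, j, l + 1, by omega, by rw [descProd_succ', mul_assoc]⟩
    · obtain rfl | hlt : k = j ∨ k < j := by omega
      · obtain ⟨l, rfl⟩ : ∃ l', l = l' + 1 := ⟨l - 1, by omega⟩
        refine ⟨h, hh, k + 1, l, by omega, ?_⟩
        rw [descProd_succ', mul_assoc, mul_assoc, hr.mul_self k (by omega), mul_one]
      · obtain ⟨j, rfl⟩ : ∃ j', j = j' + 1 := ⟨j - 1, by omega⟩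
        refine ⟨h * r j, mul_mem hh (mem_initialSubgroup (by omega)), k, l, hkl, ?_⟩
        rw [mul_assoc, hr.descProd_mul_of_lt (by omega) (by omega) (by omega), mul_assoc]
  induction hx using Subgroup.closure_induction_right with
  | one => exact ⟨1, one_mem _, m + 1, 0, rfl, by simp [descProd]⟩
  | mul_right x hx y hy ih =>
    obtain ⟨j, hj, rfl⟩ := hy
    exact step x ih j hj
  | mul_inv_cancel x hx y hy ih =>
    obtain ⟨j, hj, rfl⟩ := hy
    rw [inv_eq_of_mul_eq_one_left (hr.mul_self j (lt_of_lt_of_le hj hm))]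
    exact step x ih j hj

end SymmetricRelations

section Perm

variable {n : ℕ} {f : G →* Equiv.Perm (Fin n)}
  (hf : ∀ (i : ℕ) (h : i + 1 < n), f (r i) = Equiv.swap ⟨i, by omega⟩ ⟨i + 1, h⟩)
include hf

lemma map_apply_eq_self_of_mem_initialSubgroup {m : ℕ} {x : G} (hx : x ∈ initialSubgroup r m)
    (a : Fin n) (ha : m < a) : f x a = a := by
  induction hx using Subgroup.closure_induction with
  | mem x hx =>
    obtain ⟨j, hj, rfl⟩ := hx
    rw [Set.mem_Iio] at hj
    rw [hf j (by omega)]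
    exact Equiv.swap_apply_of_ne_of_ne (by simp [Fin.ext_iff]; omega) (by simp [Fin.ext_iff]; omega)
  | one => simp
  | mul x y _ _ hx hy => rw [map_mul, Equiv.Perm.mul_apply, hy, hx]
  | inv x _ hx => rw [map_inv, Equiv.Perm.inv_eq_iff_eq, hx]

lemma map_descProd_apply {k l : ℕ} (h : k + l < n) :
    f (descProd r k l) ⟨k, by omega⟩ = ⟨k + l, h⟩ := by
  induction l with
  | zero => simp [descProd]
  | succ l ih =>
    rw [descProd, map_mul, Equiv.Perm.mul_apply, ih (by omega), hf _ (by omega)]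
    exact Equiv.swap_apply_left _ _

lemma SymmetricRelations.mem_initialSubgroup_of_apply_eq (hr : SymmetricRelations r (n - 1))
    {m : ℕ} (hm : m < n) {x : G} (hx : x ∈ initialSubgroup r m) (hfx : f x ⟨m, hm⟩ = ⟨m, hm⟩) :
    x ∈ initialSubgroup r (m - 1) := by
  cases m with
  | zero => exact hx
  | succ m =>
    obtain ⟨h, hh, k, l, hkl, rfl⟩ := hr.exists_eq_mul_descProd (by omega) hx
    have h1 : f h ⟨m + 1, hm⟩ = ⟨m + 1, hm⟩ :=
      map_apply_eq_self_of_mem_initialSubgroup hf hh _ (by simp)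
    have h2 : f (descProd r k l) ⟨k, by omega⟩ = ⟨m + 1, hm⟩ := by
      rw [map_descProd_apply hf (by omega)]
      simp [hkl]
    have h3 : f (descProd r k l) ⟨m + 1, hm⟩ = ⟨m + 1, hm⟩ := by
      apply (f h).injective
      rw [← Equiv.Perm.mul_apply, ← map_mul, hfx, h1]
    have h4 := congrArg Fin.val ((f (descProd r k l)).injective (h2.trans h3.symm))
    obtain rfl : l = 0 := by simp only at h4; omega
    simpa [descProd] using hh

lemma SymmetricRelations.eq_one_of_map_eq_one (hr : SymmetricRelations r (n - 1))
    {x : G} (hx : x ∈ initialSubgroup r (n - 1)) (hfx : f x = 1) : x = 1 := by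
  have key : ∀ m, m ≤ n - 1 → x ∈ initialSubgroup r m → x = 1 := by
    intro m
    induction m with
    | zero =>
      intro _ h
      have h0 : Set.Iio 0 = (∅ : Set ℕ) := by simp
      rwa [initialSubgroup, h0, Set.image_empty, Subgroup.closure_empty, Subgroup.mem_bot] at h
    | succ m ih =>
      intro hm h
      exact ih (by omega)
        (hr.mem_initialSubgroup_of_apply_eq (m := m + 1) hf (by omega) h (by simp [hfx]))
  exact key _ le_rfl hx

lemma map_initialSubgroup_eq_top : (initialSubgroup r (n - 1)).map f = ⊤ := by
  cases n with
  | zero => exact Subsingleton.elim _ _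
  | succ n =>
    rw [eq_top_iff, ← Subgroup.toSubmonoid_le, Subgroup.top_toSubmonoid,
      ← Equiv.Perm.mclosure_swap_castSucc_succ, Submonoid.closure_le]
    rintro _ ⟨i, rfl⟩
    exact ⟨r i, mem_initialSubgroup i.2, hf i (by omega)⟩

/-- The symmetric group is presented by the Coxeter relations of type `A`: if `f` sends elements
satisfying them to the adjacent transpositions, then `f` has a section. -/
theorem SymmetricRelations.exists_section (hr : SymmetricRelations r (n - 1)) :
    ∃ s : Equiv.Perm (Fin n) →* G, (∀ π, f (s π) = π) ∧ (∀ π, s π ∈ initialSubgroup r (n - 1)) ∧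
      ∀ (i : ℕ) (h : i + 1 < n), s (Equiv.swap ⟨i, by omega⟩ ⟨i + 1, h⟩) = r i := by
  let e : initialSubgroup r (n - 1) ≃* Equiv.Perm (Fin n) :=
    MulEquiv.ofBijective (f.comp (initialSubgroup r (n - 1)).subtype) <| by
      constructor
      · rw [injective_iff_map_eq_one]
        exact fun x hx => Subtype.ext (hr.eq_one_of_map_eq_one hf x.2 hx)
      · intro π
        obtain ⟨x, hx, rfl⟩ : π ∈ (initialSubgroup r (n - 1)).map f := by
          rw [map_initialSubgroup_eq_top hf]; trivial
        exact ⟨⟨x, hx⟩, rfl⟩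
  refine ⟨(initialSubgroup r (n - 1)).subtype.comp e.symm.toMonoidHom, fun π => e.apply_symm_apply π,
    fun π => (e.symm π).2, fun i h => ?_⟩
  have : e ⟨r i, mem_initialSubgroup (by omega)⟩ = Equiv.swap ⟨i, by omega⟩ ⟨i + 1, h⟩ := hf i h
  rw [← this]
  exact congrArg Subtype.val (e.symm_apply_apply _)

end Perm

end SymmetricRelations

section Perm

variable {α G : Type*} [Group G]

lemma exists_perm_map_embedding {k : ℕ} (u v : Fin k ↪ α) :
    ∃ π : Equiv.Perm α, ∀ i, π (u i) = v i := by
  obtain ⟨π, hπ⟩ := Equiv.Perm.exists_smul_eq_embedding u v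
  exact ⟨π, fun i => DFunLike.congr_fun hπ i⟩

lemma exists_perm_map_pair {a b c d : α} (hab : a ≠ b) (hcd : c ≠ d) :
    ∃ π : Equiv.Perm α, π a = c ∧ π b = d := by
  obtain ⟨π, hπ⟩ := exists_perm_map_embedding
    ⟨![a, b], by intro i j; fin_cases i <;> fin_cases j <;> simp [hab, hab.symm]⟩
    ⟨![c, d], by intro i j; fin_cases i <;> fin_cases j <;> simp [hcd, hcd.symm]⟩
  exact ⟨π, hπ 0, hπ 1⟩

/-- An element centralized by the pointwise stabilizer of a pair `a ≠ b` spreads to an equivariant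
family indexed by all ordered pairs. -/
lemma exists_equivariant_family (s : Equiv.Perm α →* G) {a b : α} (hab : a ≠ b)
    {g : G} (hg : ∀ τ : Equiv.Perm α, τ a = a → τ b = b → s τ * g = g * s τ) :
    ∃ X : α → α → G, X a b = g ∧
      ∀ (π : Equiv.Perm α) (i j : α), i ≠ j → X (π i) (π j) = s π * X i j * (s π)⁻¹ := by
  choose P hP using fun p : {p : α × α // p.1 ≠ p.2} => exists_perm_map_pair hab p.2
  classical
  let X : α → α → G := fun i j =>
    if h : i ≠ j then s (P ⟨(i, j), h⟩) * g * (s (P ⟨(i, j), h⟩))⁻¹ else 1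
  have hX : ∀ π : Equiv.Perm α, X (π a) (π b) = s π * g * (s π)⁻¹ := by
    intro π
    have hne : π a ≠ π b := fun h => hab (π.injective h)
    obtain ⟨h1, h2⟩ := hP ⟨(π a, π b), hne⟩
    have hc := hg (π⁻¹ * P ⟨(π a, π b), hne⟩) (by simp [h1]) (by simp [h2])
    simp only [X, dif_pos hne]
    generalize P ⟨(π a, π b), hne⟩ = ρ at hc
    rw [map_mul, map_inv] at hc
    rw [mul_inv_eq_iff_eq_mul]
    calc s ρ * g = s π * ((s π)⁻¹ * s ρ * g) := by group
      _ = s π * g * (s π)⁻¹ * s ρ := by rw [hc]; group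
  refine ⟨X, by simpa using hX 1, fun π i j hij => ?_⟩
  obtain ⟨τ, rfl, rfl⟩ := exists_perm_map_pair hab hij
  rw [hX, ← Equiv.Perm.mul_apply, ← Equiv.Perm.mul_apply, hX, map_mul]
  group

end Perm

namespace K

variable {n : ℕ} {G : Type*} [Group G]

/-- The element `x_{i,j}` of `K n` (equal to `1` when `i = j`). -/
def gen (i j : Fin n) : K n := PresentedGroup.mk (KRels n) (Xg n i j)

lemma gen_of_ne {i j : Fin n} (h : i ≠ j) : gen i j = PresentedGroup.of ⟨(i, j), h⟩ := by
  simp only [gen, Xg, dif_neg h, PresentedGroup.of]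

lemma gen_comm {i j k l : Fin n} (hij : i ≠ j) (hkl : k ≠ l) (hik : i ≠ k) (hil : i ≠ l)
    (hjk : j ≠ k) (hjl : j ≠ l) : gen i j * gen k l = gen k l * gen i j := by
  simp only [gen, ← map_mul]
  exact PresentedGroup.mk_eq_mk_of_mul_inv_mem
    (Or.inl ⟨i, j, k, l, hij, hkl, hik, hil, hjk, hjl, rfl⟩)

lemma gen_braid {i j k : Fin n} (hij : i ≠ j) (hki : k ≠ i) (hkj : k ≠ j) :
    gen i k * gen k j * gen i k = gen k j * gen i k * gen k j := by
  simp only [gen, ← map_mul]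
  exact PresentedGroup.mk_eq_mk_of_mul_inv_mem (Or.inr ⟨i, j, k, hij, hki, hkj, rfl⟩)

lemma exists_lift (X : Fin n → Fin n → G)
    (hcomm : ∀ i j k l, i ≠ j → k ≠ l → i ≠ k → i ≠ l → j ≠ k → j ≠ l →
      X i j * X k l = X k l * X i j)
    (hbraid : ∀ i j k, i ≠ j → k ≠ i → k ≠ j →
      X i k * X k j * X i k = X k j * X i k * X k j) :
    ∃ θ : K n →* G, ∀ i j, i ≠ j → θ (gen i j) = X i j := by
  let F : KGenIdx n → G := fun p => X p.1.1 p.1.2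
  have hF : ∀ i j, i ≠ j → FreeGroup.lift F (Xg n i j) = X i j := by
    intro i j h
    rw [Xg, dif_neg h]
    exact FreeGroup.lift_apply_of
  have hrel : ∀ r ∈ KRels n, FreeGroup.lift F r = 1 := by
    rintro _ (⟨i, j, k, l, hij, hkl, hik, hil, hjk, hjl, rfl⟩ | ⟨i, j, k, hij, hki, hkj, rfl⟩)
    · rw [map_mul, map_inv, mul_inv_eq_one]
      simp only [map_mul, hF _ _ hij, hF _ _ hkl]
      exact hcomm i j k l hij hkl hik hil hjk hjl
    · rw [map_mul, map_inv, mul_inv_eq_one]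
      simp only [map_mul, hF _ _ hki.symm, hF _ _ hkj]
      exact hbraid i j k hij hki hkj
  refine ⟨PresentedGroup.toGroup hrel, fun i j h => ?_⟩
  rw [gen_of_ne h]
  exact PresentedGroup.toGroup.of hrel

lemma hom_ext {θ θ' : K n →* G} (h : ∀ i j, i ≠ j → θ (gen i j) = θ' (gen i j)) : θ = θ' := by
  apply PresentedGroup.ext
  rintro ⟨⟨i, j⟩, hij⟩
  simpa only [gen_of_ne hij] using h i j hij

lemma exists_permAction (n : ℕ) : ∃ φ : Equiv.Perm (Fin n) →* MulAut (K n),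
    ∀ (π : Equiv.Perm (Fin n)) (i j : Fin n), i ≠ j → φ π (gen i j) = gen (π i) (π j) := by
  have hex : ∀ π : Equiv.Perm (Fin n), ∃ θ : K n →* K n,
      ∀ i j, i ≠ j → θ (gen i j) = gen (π i) (π j) := fun π =>
    exists_lift (fun i j => gen (π i) (π j))
      (fun i j k l h1 h2 h3 h4 h5 h6 => gen_comm (π.injective.ne h1) (π.injective.ne h2)
        (π.injective.ne h3) (π.injective.ne h4) (π.injective.ne h5) (π.injective.ne h6))
      (fun i j k h1 h2 h3 => gen_braid (π.injective.ne h1) (π.injective.ne h2)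
        (π.injective.ne h3))
  choose θ hθ using hex
  have hone : θ 1 = MonoidHom.id _ := hom_ext fun i j h => by rw [hθ _ _ _ h]; rfl
  have hmul : ∀ π τ, θ (π * τ) = (θ π).comp (θ τ) := fun π τ => hom_ext fun i j h => by
    rw [hθ _ _ _ h, MonoidHom.comp_apply, hθ _ _ _ h, hθ _ _ _ (τ.injective.ne h)]; rfl
  refine ⟨MonoidHom.mk' (fun π => (θ π).toMulEquiv (θ π⁻¹) ?_ ?_) fun π τ => ?_, fun π i j h => ?_⟩
  · rw [← hmul, inv_mul_cancel, hone]
  · rw [← hmul, mul_inv_cancel, hone]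
  · ext x
    exact DFunLike.congr_fun (hmul π τ) x
  · exact hθ π i j h

end K

section sw

variable {n : ℕ}

lemma sw_mul_sw_comm {i j : Fin (n - 1)} (h : (i : ℕ) + 2 ≤ j ∨ (j : ℕ) + 2 ≤ i) :
    sw n i * sw n j = sw n j * sw n i := by
  rw [sw, sw, Equiv.mul_swap_eq_swap_mul, Equiv.swap_apply_of_ne_of_ne,
    Equiv.swap_apply_of_ne_of_ne] <;> simp [Fin.ext_iff] <;> omega

lemma sw_apply_of_add_one_lt {i : Fin (n - 1)} {a : Fin n} (h : (a : ℕ) < i ∨ (i : ℕ) + 1 < a) :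
    sw n i a = a :=
  Equiv.swap_apply_of_ne_of_ne (by simp [Fin.ext_iff]; omega) (by simp [Fin.ext_iff]; omega)

lemma sw_mul_sw_apply_left {i j : Fin (n - 1)} (h : (i : ℕ) + 1 = j) :
    (sw n i * sw n j) ⟨i, by omega⟩ = ⟨j, by omega⟩ := by
  have hj : sw n j ⟨i, by omega⟩ = ⟨i, by omega⟩ := sw_apply_of_add_one_lt (Or.inl (by simp; omega))
  rw [Equiv.Perm.mul_apply, hj]
  exact (Equiv.swap_apply_left _ _).trans (Fin.ext h)

lemma sw_mul_sw_apply_right {i j : Fin (n - 1)} (h : (i : ℕ) + 1 = j) :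
    (sw n i * sw n j) ⟨i + 1, by omega⟩ = ⟨j + 1, by omega⟩ := by
  have hi : (⟨i + 1, by omega⟩ : Fin n) = ⟨j, by omega⟩ := Fin.ext h
  have hj : sw n j ⟨j, by omega⟩ = ⟨j + 1, by omega⟩ := Equiv.swap_apply_left _ _
  rw [hi, Equiv.Perm.mul_apply, hj, sw_apply_of_add_one_lt (Or.inr (by simp; omega))]

lemma sw_braid {i j : Fin (n - 1)} (h : (i : ℕ) + 1 = j) :
    sw n i * sw n j * sw n i = sw n j * sw n i * sw n j := by
  rw [mul_assoc (sw n j)]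
  refine (Equiv.mul_swap_eq_swap_mul _ _ _).trans ?_
  rw [sw_mul_sw_apply_left h, sw_mul_sw_apply_right h]
  rfl

end sw

namespace VB

variable {n : ℕ}

lemma σv_braid {i j : Fin (n - 1)} (h : (i : ℕ) + 1 = j) :
    σv n i * σv n j * σv n i = σv n j * σv n i * σv n j :=
  PresentedGroup.mk_eq_mk_of_mul_inv_mem (rels := vbRels n) ⟨i, j, Or.inl ⟨h, rfl⟩⟩

lemma σv_comm {i j : Fin (n - 1)} (h : (i : ℕ) + 2 ≤ j ∨ (j : ℕ) + 2 ≤ i) :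
    σv n i * σv n j = σv n j * σv n i :=
  PresentedGroup.mk_eq_mk_of_mul_inv_mem (rels := vbRels n) ⟨i, j, Or.inr (Or.inl ⟨h, rfl⟩)⟩

lemma ρv_braid {i j : Fin (n - 1)} (h : (i : ℕ) + 1 = j) :
    ρv n i * ρv n j * ρv n i = ρv n j * ρv n i * ρv n j :=
  PresentedGroup.mk_eq_mk_of_mul_inv_mem (rels := vbRels n)
    ⟨i, j, Or.inr (Or.inr (Or.inl ⟨h, rfl⟩))⟩

lemma ρv_comm {i j : Fin (n - 1)} (h : (i : ℕ) + 2 ≤ j ∨ (j : ℕ) + 2 ≤ i) :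
    ρv n i * ρv n j = ρv n j * ρv n i :=
  PresentedGroup.mk_eq_mk_of_mul_inv_mem (rels := vbRels n)
    ⟨i, j, Or.inr (Or.inr (Or.inr (Or.inl ⟨h, rfl⟩)))⟩

lemma ρv_mul_self (i : Fin (n - 1)) : ρv n i * ρv n i = 1 :=
  PresentedGroup.one_of_mem (rels := vbRels n)
    ⟨i, i, Or.inr (Or.inr (Or.inr (Or.inr (Or.inl rfl))))⟩

lemma σv_ρv_comm {i j : Fin (n - 1)} (h : (i : ℕ) + 2 ≤ j ∨ (j : ℕ) + 2 ≤ i) :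
    σv n i * ρv n j = ρv n j * σv n i :=
  PresentedGroup.mk_eq_mk_of_mul_inv_mem (rels := vbRels n)
    ⟨i, j, Or.inr (Or.inr (Or.inr (Or.inr (Or.inr (Or.inl ⟨h, rfl⟩)))))⟩

lemma ρv_ρv_σv {i j : Fin (n - 1)} (h : (i : ℕ) + 1 = j) :
    ρv n i * ρv n j * σv n i = σv n j * ρv n i * ρv n j :=
  PresentedGroup.mk_eq_mk_of_mul_inv_mem (rels := vbRels n)
    ⟨i, j, Or.inr (Or.inr (Or.inr (Or.inr (Or.inr (Or.inr ⟨h, rfl⟩)))))⟩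

lemma hom_ext {G : Type*} [Group G] {F F' : VB n →* G} (hσ : ∀ i, F (σv n i) = F' (σv n i))
    (hρ : ∀ i, F (ρv n i) = F' (ρv n i)) : F = F' :=
  PresentedGroup.ext fun x => x.casesOn hσ hρ

/-- The elements `x_{i,i+1}` and the adjacent transpositions satisfy the relations of `VB n`. -/
lemma exists_toSemidirectProduct {φ : Equiv.Perm (Fin n) →* MulAut (K n)}
    (hφ : ∀ (π : Equiv.Perm (Fin n)) (i j : Fin n), i ≠ j →
      φ π (K.gen i j) = K.gen (π i) (π j)) :
    ∃ Ψ : VB n →* K n ⋊[φ] Equiv.Perm (Fin n),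
      (∀ i : Fin (n - 1), Ψ (σv n i) =
        SemidirectProduct.inl (K.gen ⟨i, by omega⟩ ⟨i + 1, by omega⟩)) ∧
      ∀ i, Ψ (ρv n i) = SemidirectProduct.inr (sw n i) := by
  let x : Fin (n - 1) → K n := fun i => K.gen ⟨i, by omega⟩ ⟨i + 1, by omega⟩
  have hx : ∀ (π : Equiv.Perm (Fin n)) (i : Fin (n - 1)),
      φ π (x i) = K.gen (π ⟨i, by omega⟩) (π ⟨i + 1, by omega⟩) :=
    fun π i => hφ π _ _ (by simp)
  have hinr : ∀ (π : Equiv.Perm (Fin n)) (y : K n),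
      (SemidirectProduct.inr π * SemidirectProduct.inl y : K n ⋊[φ] Equiv.Perm (Fin n)) =
        SemidirectProduct.inl (φ π y) * SemidirectProduct.inr π := by
    intro π y
    rw [SemidirectProduct.inl_aut, map_inv, inv_mul_cancel_right]
  let F : Fin (n - 1) ⊕ Fin (n - 1) → K n ⋊[φ] Equiv.Perm (Fin n) :=
    Sum.elim (fun i => SemidirectProduct.inl (x i)) (fun i => SemidirectProduct.inr (sw n i))
  have hFσ : ∀ i, FreeGroup.lift F (σg n i) = SemidirectProduct.inl (x i) :=
    fun i => FreeGroup.lift_apply_of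
  have hFρ : ∀ i, FreeGroup.lift F (ρg n i) = SemidirectProduct.inr (sw n i) :=
    fun i => FreeGroup.lift_apply_of
  have hrel : ∀ r ∈ vbRels n, FreeGroup.lift F r = 1 := by
    rintro r ⟨i, j, ⟨h, rfl⟩ | ⟨h, rfl⟩ | ⟨h, rfl⟩ | ⟨h, rfl⟩ | rfl | ⟨h, rfl⟩ | ⟨h, rfl⟩⟩ <;>
      simp only [map_mul, map_inv, hFσ, hFρ, mul_inv_eq_one]
    · simp only [← map_mul]
      congr 1
      have hi : (⟨i + 1, by omega⟩ : Fin n) = ⟨j, by omega⟩ := Fin.ext h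
      simp only [x, hi]
      exact K.gen_braid (by simp; omega) (by simp; omega) (by simp)
    · simp only [← map_mul]
      congr 1
      exact K.gen_comm (by simp) (by simp) (by simp; omega) (by simp; omega) (by simp; omega)
        (by simp; omega)
    · simp only [← map_mul]
      rw [sw_braid h]
    · simp only [← map_mul]
      rw [sw_mul_sw_comm h]
    · rw [← map_mul, sw, Equiv.swap_mul_self, map_one]
    · rw [hinr, hx, sw_apply_of_add_one_lt (by simp; omega),
        sw_apply_of_add_one_lt (by simp; omega)]
    · rw [← map_mul, hinr, hx, sw_mul_sw_apply_left h, sw_mul_sw_apply_right h, map_mul, mul_assoc]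
  exact ⟨PresentedGroup.toGroup hrel, fun i => PresentedGroup.toGroup.of hrel,
    fun i => PresentedGroup.toGroup.of hrel⟩

/-- `ρv n`, extended by `1` to all natural numbers. -/
def ρNat (n i : ℕ) : VB n := if h : i < n - 1 then ρv n ⟨i, h⟩ else 1

lemma ρNat_of_lt {i : ℕ} (h : i < n - 1) : ρNat n i = ρv n ⟨i, h⟩ := dif_pos h

lemma symmetricRelations (n : ℕ) : SymmetricRelations (ρNat n) (n - 1) where
  mul_self i hi := by
    rw [ρNat_of_lt hi, ρv_mul_self]
  comm i j hij hj := by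
    rw [ρNat_of_lt (by omega : i < n - 1), ρNat_of_lt hj]
    exact ρv_comm (Or.inl hij)
  braid i hi := by
    rw [ρNat_of_lt (by omega : i < n - 1), ρNat_of_lt hi]
    exact ρv_braid rfl

/-- A splitting of `VB n → S_n`, together with the family of conjugates of the `σ_i`. -/
lemma exists_section_and_family (hn : 2 ≤ n) {μ : VB n →* Equiv.Perm (Fin n)}
    (hμ : ∀ i, μ (ρv n i) = sw n i) :
    ∃ (s : Equiv.Perm (Fin n) →* VB n) (X : Fin n → Fin n → VB n),
      (∀ i, s (sw n i) = ρv n i) ∧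
      (∀ i : Fin (n - 1), X ⟨i, by omega⟩ ⟨i + 1, by omega⟩ = σv n i) ∧
      ∀ (π : Equiv.Perm (Fin n)) (i j : Fin n), i ≠ j → X (π i) (π j) = s π * X i j * (s π)⁻¹ := by
  obtain ⟨m, rfl⟩ : ∃ m, n = m + 2 := ⟨n - 2, by omega⟩
  have hf : ∀ (i : ℕ) (h : i + 1 < m + 2),
      μ (ρNat (m + 2) i) = Equiv.swap ⟨i, by omega⟩ ⟨i + 1, h⟩ := by
    intro i h
    rw [ρNat_of_lt (by omega), hμ]
    rfl
  have hr := symmetricRelations (m + 2)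
  obtain ⟨s, hs, hmem, hsw⟩ := hr.exists_section hf
  have hsw' : ∀ i, s (sw (m + 2) i) = ρv (m + 2) i := by
    intro i
    rw [← ρNat_of_lt i.2]
    exact hsw i (by omega)
  have hcent : ∀ τ : Equiv.Perm (Fin (m + 2)), τ ⟨m, by omega⟩ = ⟨m, by omega⟩ →
      τ ⟨m + 1, by omega⟩ = ⟨m + 1, by omega⟩ →
      s τ * σv (m + 2) ⟨m, by omega⟩ = σv (m + 2) ⟨m, by omega⟩ * s τ := by
    intro τ h0 h1
    have h2 : s τ ∈ initialSubgroup (ρNat (m + 2)) m :=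
      hr.mem_initialSubgroup_of_apply_eq (m := m + 1) hf (by omega) (hmem τ) (by rw [hs, h1])
    have h3 : s τ ∈ initialSubgroup (ρNat (m + 2)) (m - 1) :=
      hr.mem_initialSubgroup_of_apply_eq (m := m) hf (by omega) h2 (by rw [hs, h0])
    have h4 : initialSubgroup (ρNat (m + 2)) (m - 1) ≤
        Subgroup.centralizer {σv (m + 2) ⟨m, by omega⟩} := by
      rw [initialSubgroup, Subgroup.closure_le]
      rintro _ ⟨j, hj, rfl⟩
      rw [Set.mem_Iio] at hj
      rw [SetLike.mem_coe, Subgroup.mem_centralizer_singleton_iff, ρNat_of_lt (by omega)]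
      exact (σv_ρv_comm (Or.inr (by simp; omega))).symm
    exact Subgroup.mem_centralizer_singleton_iff.1 (h4 h3)
  obtain ⟨X, hX, hXs⟩ := exists_equivariant_family s (by simp) hcent
  have hXσ : ∀ t i : ℕ, (h : i + t = m) →
      X ⟨i, by omega⟩ ⟨i + 1, by omega⟩ = σv (m + 2) ⟨i, by omega⟩ := by
    intro t
    induction t with
    | zero => rintro i rfl; exact hX
    | succ t ih =>
      intro i h
      let a : Fin (m + 2 - 1) := ⟨i, by omega⟩
      let b : Fin (m + 2 - 1) := ⟨i + 1, by omega⟩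
      have hab : (a : ℕ) + 1 = b := rfl
      have h1 := hXs (sw (m + 2) a * sw (m + 2) b) ⟨a, by omega⟩ ⟨a + 1, by omega⟩ (by simp)
      rw [sw_mul_sw_apply_left hab, sw_mul_sw_apply_right hab, ih (i + 1) (by omega), map_mul,
        hsw', hsw', eq_mul_inv_iff_mul_eq, ← mul_assoc] at h1
      exact (mul_left_cancel (h1.symm.trans (ρv_ρv_σv hab).symm) :)
  exact ⟨s, X, hsw', fun i => hXσ (m - i) i (by omega), hXs⟩

end VB

/-- An equivariant family extending `i ↦ σ_i` satisfies the relations of `K n`. -/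
lemma K.exists_lift_of_equivariant {n : ℕ} {s : Equiv.Perm (Fin n) →* VB n}
    {X : Fin n → Fin n → VB n}
    (hXσ : ∀ i : Fin (n - 1), X ⟨i, by omega⟩ ⟨i + 1, by omega⟩ = σv n i)
    (hX : ∀ (π : Equiv.Perm (Fin n)) (i j : Fin n), i ≠ j →
      X (π i) (π j) = s π * X i j * (s π)⁻¹) :
    ∃ θ : K n →* VB n, ∀ i j, i ≠ j → θ (K.gen i j) = X i j := by
  refine K.exists_lift X (fun i j k l hij hkl hik hil hjk hjl => ?_) fun i j k hij hki hkj => ?_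
  · let v : Fin 4 ↪ Fin n := ⟨![i, j, k, l], by
      intro a b
      fin_cases a <;> fin_cases b <;>
        simp [hij, hkl, hik, hil, hjk, hjl, hij.symm, hkl.symm, hik.symm, hil.symm, hjk.symm,
          hjl.symm]⟩
    have hn : 4 ≤ n := by simpa using Fintype.card_le_of_embedding v
    obtain ⟨π, hπ⟩ := exists_perm_map_embedding (Fin.castLEEmb hn) v
    have h01 := hX π (Fin.castLEEmb hn 0) (Fin.castLEEmb hn 1) (by simp)
    have h23 := hX π (Fin.castLEEmb hn 2) (Fin.castLEEmb hn 3) (by simp)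
    rw [hπ, hπ] at h01 h23
    replace h01 : X i j = MulAut.conj (s π) (σv n ⟨0, by omega⟩) :=
      h01.trans (congrArg (s π * · * (s π)⁻¹) (hXσ ⟨0, by omega⟩))
    replace h23 : X k l = MulAut.conj (s π) (σv n ⟨2, by omega⟩) :=
      h23.trans (congrArg (s π * · * (s π)⁻¹) (hXσ ⟨2, by omega⟩))
    rw [h01, h23, ← map_mul, VB.σv_comm (by simp), map_mul]
  · let v : Fin 3 ↪ Fin n := ⟨![i, k, j], by
      intro a b
      fin_cases a <;> fin_cases b <;> simp [hij, hki, hkj, hij.symm, hki.symm, hkj.symm]⟩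
    have hn : 3 ≤ n := by simpa using Fintype.card_le_of_embedding v
    obtain ⟨π, hπ⟩ := exists_perm_map_embedding (Fin.castLEEmb hn) v
    have h01 := hX π (Fin.castLEEmb hn 0) (Fin.castLEEmb hn 1) (by simp)
    have h12 := hX π (Fin.castLEEmb hn 1) (Fin.castLEEmb hn 2) (by simp)
    rw [hπ, hπ] at h01 h12
    replace h01 : X i k = MulAut.conj (s π) (σv n ⟨0, by omega⟩) :=
      h01.trans (congrArg (s π * · * (s π)⁻¹) (hXσ ⟨0, by omega⟩))
    replace h12 : X k j = MulAut.conj (s π) (σv n ⟨1, by omega⟩) :=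
      h12.trans (congrArg (s π * · * (s π)⁻¹) (hXσ ⟨1, by omega⟩))
    simp only [h01, h12, ← map_mul]
    rw [VB.σv_braid (by simp)]

lemma perm_hom_ext {n : ℕ} {M : Type*} [Monoid M] {F F' : Equiv.Perm (Fin n) →* M}
    (h : ∀ i, F (sw n i) = F' (sw n i)) : F = F' := by
  cases n with
  | zero => ext π; rw [Subsingleton.elim π 1, map_one, map_one]
  | succ n =>
    refine MonoidHom.eq_of_eqOn_denseM (Equiv.Perm.mclosure_swap_castSucc_succ n) ?_
    rintro _ ⟨i, rfl⟩
    exact h i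

/-- For every `n ≥ 2`, the virtual braid group `VB_n` is isomorphic to the
semidirect product `K_n ⋊ S_n`, where `S_n` acts on `K_n` by permutation of indices:
`π · x_{i,j} = x_{π(i), π(j)}`. -/
theorem vb_iso_k_semidirect_sn (n : ℕ) (hn : 2 ≤ n) :
    ∃ φ : Equiv.Perm (Fin n) →* MulAut (K n),
      (∀ (π : Equiv.Perm (Fin n)) (i j : Fin n) (h : i ≠ j),
        φ π (PresentedGroup.of ⟨(i, j), h⟩) =
          PresentedGroup.of ⟨(π i, π j), fun he => h (π.injective he)⟩) ∧
      Nonempty (VB n ≃* K n ⋊[φ] Equiv.Perm (Fin n)) := by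
  obtain ⟨φ, hφ⟩ := K.exists_permAction n
  refine ⟨φ, fun π i j h => ?_, ?_⟩
  · rw [← K.gen_of_ne h, hφ π i j h, K.gen_of_ne]
  obtain ⟨Ψ, hΨσ, hΨρ⟩ := VB.exists_toSemidirectProduct hφ
  obtain ⟨s, X, hs, hXσ, hX⟩ := VB.exists_section_and_family hn
    (μ := SemidirectProduct.rightHom.comp Ψ) (fun i => by simp [hΨρ])
  obtain ⟨θ, hθ⟩ := K.exists_lift_of_equivariant hXσ hX
  have hcompat : ∀ π, θ.comp (φ π).toMonoidHom = (MulAut.conj (s π)).toMonoidHom.comp θ := by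
    intro π
    refine K.hom_ext fun i j h => ?_
    change θ (φ π (K.gen i j)) = s π * θ (K.gen i j) * (s π)⁻¹
    rw [hφ π i j h, hθ _ _ (π.injective.ne h), hθ i j h, hX π i j h]
  let Θ : K n ⋊[φ] Equiv.Perm (Fin n) →* VB n := SemidirectProduct.lift θ s hcompat
  have hΘΨ : Θ.comp Ψ = MonoidHom.id _ := by
    refine VB.hom_ext (fun i => ?_) fun i => ?_
    · rw [MonoidHom.comp_apply, hΨσ, SemidirectProduct.lift_inl, hθ _ _ (by simp), hXσ]
      rfl
    · rw [MonoidHom.comp_apply, hΨρ, SemidirectProduct.lift_inr, hs]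
      rfl
  have hΨs : Ψ.comp s = SemidirectProduct.inr :=
    perm_hom_ext fun i => by rw [MonoidHom.comp_apply, hs, hΨρ]
  have hΨX : ∀ i j, i ≠ j → Ψ (X i j) = SemidirectProduct.inl (K.gen i j) := by
    intro i j hij
    let a : Fin (n - 1) := ⟨0, by omega⟩
    have hab : (⟨a, by omega⟩ : Fin n) ≠ ⟨a + 1, by omega⟩ := by simp
    obtain ⟨π, rfl, rfl⟩ := exists_perm_map_pair hab hij
    rw [hX π _ _ hab, hXσ a, map_mul, map_mul, map_inv, hΨσ, ← MonoidHom.comp_apply, hΨs,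
      ← map_inv, ← SemidirectProduct.inl_aut, hφ π _ _ hab]
  have hΨΘ : Ψ.comp Θ = MonoidHom.id _ := by
    refine SemidirectProduct.hom_ext (K.hom_ext fun i j hij => ?_) ?_
    · change Ψ (Θ (SemidirectProduct.inl (K.gen i j))) = SemidirectProduct.inl (K.gen i j)
      rw [SemidirectProduct.lift_inl, hθ i j hij, hΨX i j hij]
    · rw [MonoidHom.comp_assoc, SemidirectProduct.lift_comp_inr, hΨs]
      rfl
  exact ⟨Ψ.toMulEquiv Θ hΘΨ hΨΘ⟩
end

section
/- The group H_2, the kernel of the homomorphism μ : VB_2 → S_2 defined by μ(σ_1) = 1 and μ(ρ_1) = (1 2), is a free group of rank 2, i.e. isomorphic to the free product ℤ * ℤ. -/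
/-- The free group on `σ` and `ρσρ⁻¹`, mapped to `VB 2`. -/
def conjHom : FreeGroup (Fin 2) →* VB 2 :=
  FreeGroup.lift ![σv 2 0, ρv 2 0 * σv 2 0 * (ρv 2 0)⁻¹]

/-- The action of `S_2` on the free group of rank `2` permuting the free generators. -/
def permFree : Equiv.Perm (Fin 2) →* MulAut (FreeGroup (Fin 2)) where
  toFun e := FreeGroup.freeGroupCongr e
  map_one' := by ext x : 1; simp
  map_mul' e f := by
    ext x : 1
    change FreeGroup.map _ x = FreeGroup.map _ (FreeGroup.map _ x)
    rw [FreeGroup.map.comp]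
    rfl

lemma permFree_of (e : Equiv.Perm (Fin 2)) (i : Fin 2) :
    permFree e (FreeGroup.of i) = FreeGroup.of (e i) :=
  FreeGroup.map.of

lemma ρv_two_mul_self : ρv 2 0 * ρv 2 0 = 1 :=
  PresentedGroup.one_of_mem (rels := vbRels 2) (x := ρg 2 0 * ρg 2 0)
    ⟨0, 0, Or.inr (Or.inr (Or.inr (Or.inr (Or.inl rfl))))⟩

/-- The images of the generators of `VB 2` in the semidirect product of a free group
of rank `2` with `S_2`. -/
def semidirectGen : Fin (2 - 1) ⊕ Fin (2 - 1) →
    FreeGroup (Fin 2) ⋊[permFree] Equiv.Perm (Fin 2) :=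
  Sum.elim (fun _ => SemidirectProduct.inl (FreeGroup.of 0))
    (fun _ => SemidirectProduct.inr (Equiv.swap 0 1))

lemma lift_semidirectGen_eq_one : ∀ r ∈ vbRels 2, FreeGroup.lift semidirectGen r = 1 := by
  rintro r ⟨i, j, h⟩
  have hi := i.isLt
  have hj := j.isLt
  rcases h with h | h | h | h | h | h | h
  on_goal 5 =>
    subst h
    simp only [ρg, map_mul, FreeGroup.lift_apply_of, semidirectGen, Sum.elim_inr]
    rw [← map_mul, Equiv.swap_mul_self, map_one]
  all_goals
    obtain ⟨h, -⟩ := h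
    omega

/-- The homomorphism from `VB 2` to the semidirect product given by `semidirectGen`. -/
def toSemidirect : VB 2 →* FreeGroup (Fin 2) ⋊[permFree] Equiv.Perm (Fin 2) :=
  PresentedGroup.toGroup lift_semidirectGen_eq_one

lemma toSemidirect_conjHom (w : FreeGroup (Fin 2)) :
    toSemidirect (conjHom w) = SemidirectProduct.inl w := by
  have hσ : toSemidirect (σv 2 0) = SemidirectProduct.inl (FreeGroup.of 0) :=
    PresentedGroup.toGroup.of lift_semidirectGen_eq_one
  have hρ : toSemidirect (ρv 2 0) = SemidirectProduct.inr (Equiv.swap 0 1) :=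
    PresentedGroup.toGroup.of lift_semidirectGen_eq_one
  suffices h : toSemidirect.comp conjHom = SemidirectProduct.inl from DFunLike.congr_fun h w
  ext i : 1
  fin_cases i
  · simp [conjHom, hσ]
  · simp only [conjHom, Fin.mk_one, MonoidHom.comp_apply, FreeGroup.lift_apply_of,
      Matrix.cons_val_one, Matrix.cons_val_fin_one, map_mul, map_inv, hσ, hρ]
    rw [← map_inv, ← SemidirectProduct.inl_aut, permFree_of, Equiv.swap_apply_left]

lemma conjHom_injective : Function.Injective conjHom := fun a b h =>
  SemidirectProduct.inl_injective <| by
    rw [← toSemidirect_conjHom, ← toSemidirect_conjHom, h]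

lemma ρv_mul_conjHom (w : FreeGroup (Fin 2)) :
    ρv 2 0 * conjHom w = conjHom (permFree (Equiv.swap 0 1) w) * ρv 2 0 := by
  have hinv : (ρv 2 0)⁻¹ = ρv 2 0 := inv_eq_of_mul_eq_one_left ρv_two_mul_self
  rw [← mul_inv_eq_iff_eq_mul]
  suffices h : (MulAut.conj (ρv 2 0)).toMonoidHom.comp conjHom =
      conjHom.comp (permFree (Equiv.swap 0 1)).toMonoidHom from DFunLike.congr_fun h w
  ext i : 1
  simp only [MonoidHom.comp_apply, MulEquiv.toMonoidHom_eq_coe, MonoidHom.coe_coe, permFree_of,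
    MulAut.conj_apply]
  fin_cases i
  · simp [conjHom]
  · simp only [conjHom, Fin.mk_one, FreeGroup.lift_apply_of, Equiv.swap_apply_right,
      Matrix.cons_val_one, Matrix.cons_val_fin_one, Matrix.cons_val_zero, hinv]
    rw [← mul_assoc, ← mul_assoc, ρv_two_mul_self, one_mul, mul_assoc, ρv_two_mul_self, mul_one]

lemma exists_eq_conjHom_or_mul_ρv (g : VB 2) :
    ∃ w, g = conjHom w ∨ g = conjHom w * ρv 2 0 := by
  have hinv : (ρv 2 0)⁻¹ = ρv 2 0 := inv_eq_of_mul_eq_one_left ρv_two_mul_self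
  have hσ : conjHom (FreeGroup.of 0) = σv 2 0 := by simp [conjHom]
  have hgen : ∀ x, PresentedGroup.of (rels := vbRels 2) x = σv 2 0 ∨
      PresentedGroup.of (rels := vbRels 2) x = ρv 2 0 := by
    rintro (x | x)
    · exact Or.inl (congrArg (σv 2) (Subsingleton.elim (α := Fin 1) x 0))
    · exact Or.inr (congrArg (ρv 2) (Subsingleton.elim (α := Fin 1) x 0))
  obtain ⟨x, rfl⟩ := PresentedGroup.mk_surjective (vbRels 2) g
  induction x using FreeGroup.induction_on with
  | C1 => exact ⟨1, Or.inl (by simp)⟩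
  | of x =>
    rcases hgen x with h | h
    · exact ⟨FreeGroup.of 0, Or.inl (h.trans hσ.symm)⟩
    · exact ⟨1, Or.inr (h.trans (by simp))⟩
  | inv_of x _ =>
    change ∃ w, (PresentedGroup.of x)⁻¹ = _ ∨ (PresentedGroup.of x)⁻¹ = _
    rcases hgen x with h | h
    · exact ⟨(FreeGroup.of 0)⁻¹, Or.inl (by rw [h, map_inv, hσ])⟩
    · exact ⟨1, Or.inr (by rw [h, hinv, map_one, one_mul])⟩
  | mul x y hx hy =>
    obtain ⟨v, hv⟩ := hx
    obtain ⟨w, hw⟩ := hy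
    simp only [map_mul]
    rcases hv with hv | hv <;> rcases hw with hw | hw <;> rw [hv, hw]
    · exact ⟨v * w, Or.inl (by rw [map_mul])⟩
    · exact ⟨v * w, Or.inr (by rw [map_mul, mul_assoc])⟩
    · exact ⟨v * permFree (Equiv.swap 0 1) w, Or.inr (by
        rw [map_mul, mul_assoc, ρv_mul_conjHom, mul_assoc])⟩
    · exact ⟨v * permFree (Equiv.swap 0 1) w, Or.inl (by
        rw [map_mul, mul_assoc, ← mul_assoc (ρv 2 0), ρv_mul_conjHom, mul_assoc (conjHom _),
          ρv_two_mul_self, mul_one])⟩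

/-- The group `H_2 = ker μ`, the normal closure of `B_2` in `VB_2`,
is a free group of rank `2` (i.e. isomorphic to `ℤ * ℤ`). -/
theorem h2_free_of_rank_two (μ : VB 2 →* Equiv.Perm (Fin 2)) (hμ : IsMu 2 μ) :
    Nonempty (μ.ker ≃* FreeGroup (Fin 2)) := by
  have hker : ∀ w, μ (conjHom w) = 1 := by
    intro w
    suffices h : μ.comp conjHom = 1 from DFunLike.congr_fun h w
    ext i : 1
    fin_cases i <;> simp [conjHom, (hμ 0).1]
  have hrange : conjHom.range = μ.ker := by
    apply le_antisymm
    · rintro _ ⟨w, rfl⟩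
      exact hker w
    · intro g hg
      obtain ⟨w, rfl | rfl⟩ := exists_eq_conjHom_or_mul_ρv g
      · exact ⟨w, rfl⟩
      · rw [MonoidHom.mem_ker, map_mul, hker, one_mul, (hμ 0).2] at hg
        exact absurd hg (by decide)
  exact ⟨((MonoidHom.ofInjective conjHom_injective).trans
    (MulEquiv.subgroupCongr hrange)).symm⟩
end
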